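/- Let ⊢ Γ be a classical 𝓛_C-sequent and F an intuitionistic ⊥-free formula. If ⊢ Γ is provable in LLW (respectively, in ELLW), then Γ^[F] ⊢ F is provable in ILLW (respectively, in IELW). -/

import Mathlib

namespace Affine

/-- Intuitionistic formulas: the language 𝓛 (⊗, ⊸, &, ⊕, !, 1, ⊤, ⊥, 0)
together with the extra ILAL modality §. -/
inductive IForm : Type where
  | var (n : ℕ)
  | one
  | top
  | bot
  | zero
  | tensor (A B : IForm)
  | limp (A B : IForm)
  | and (A B : IForm)
  | or (A B : IForm)
  | bang (A : IForm)
  | para (A : IForm)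

namespace IForm

/-- membership in the language 𝓛 (no §) -/
def inL : IForm → Prop
  | para _ => False
  | tensor A B => inL A ∧ inL B
  | limp A B => inL A ∧ inL B
  | and A B => inL A ∧ inL B
  | or A B => inL A ∧ inL B
  | bang A => inL A
  | _ => True

/-- membership in the ⊥-free language 𝓛⁺ -/
def inLp : IForm → Prop
  | para _ => False
  | bot => False
  | tensor A B => inLp A ∧ inLp B
  | limp A B => inLp A ∧ inLp B
  | and A B => inLp A ∧ inLp B
  | or A B => inLp A ∧ inLp B
  | bang A => inLp A
  | _ => True

/-- {⊗,⊸,&,⊕,1,⊥}-formulas -/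
def inFLei : IForm → Prop
  | var _ => True
  | one => True
  | bot => True
  | tensor A B => inFLei A ∧ inFLei B
  | limp A B => inFLei A ∧ inFLei B
  | and A B => inFLei A ∧ inFLei B
  | or A B => inFLei A ∧ inFLei B
  | _ => False

/-- {⊗,⊸,&,⊕,1}-formulas -/
def inFLeiP : IForm → Prop
  | var _ => True
  | one => True
  | tensor A B => inFLeiP A ∧ inFLeiP B
  | limp A B => inFLeiP A ∧ inFLeiP B
  | and A B => inFLeiP A ∧ inFLeiP B
  | or A B => inFLeiP A ∧ inFLeiP B
  | _ => False

/-- purely implicational ({⊸}-) formulas -/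
def inImp : IForm → Prop
  | var _ => True
  | limp A B => inImp A ∧ inImp B
  | _ => False

/-- {⊸,!}-formulas -/
def inImpBang : IForm → Prop
  | var _ => True
  | limp A B => inImpBang A ∧ inImpBang B
  | bang A => inImpBang A
  | _ => False

/-- {⊸,!,§}-formulas: the language of ILAL -/
def inLAL : IForm → Prop
  | var _ => True
  | limp A B => inLAL A ∧ inLAL B
  | bang A => inLAL A
  | para A => inLAL A
  | _ => False

end IForm

/-- A parametrized intuitionistic sequent calculus: `K` is the set of allowed
formulas (the fragment), `ax` the set of non-logical axioms, and the remaining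
fields tell which optional rules are available. -/
structure ICalc where
  K : IForm → Prop
  ax : Set IForm
  wL : Prop      -- unrestricted left weakening (W)
  wR : Prop      -- right weakening (W')
  bD : Prop      -- dereliction (!D)
  bP : Prop      -- promotion (!P)
  bF : Prop      -- functorial promotion (!F)
  bW : Prop      -- !-weakening (!W), for linear systems
  lB : Prop      -- the ILAL rule (!)
  lP : Prop      -- the ILAL rule (§)

/-- Provability of an intuitionistic sequent `Γ ⊢ X` (X a stoup) in the
parametrized calculus `C`. -/
inductive IPrv (C : ICalc) : Multiset IForm → Option IForm → Prop where
  | axiom' {B} : B ∈ C.ax → IPrv C 0 (some B)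
  | init {A} : C.K A → IPrv C {A} (some A)
  | oneR : C.K .one → IPrv C 0 (some .one)
  | botL : C.K .bot → IPrv C {.bot} none
  | topR {Γ} : C.K .top → (∀ A ∈ Γ, C.K A) → IPrv C Γ (some .top)
  | zeroL {Γ X} : C.K .zero → (∀ A ∈ Γ, C.K A) → (∀ A, X = some A → C.K A) →
      IPrv C (.zero ::ₘ Γ) X
  | cut {Γ Δ X A} : IPrv C Γ (some A) → IPrv C (A ::ₘ Δ) X → IPrv C (Γ + Δ) X
  | oneL {Γ X} : C.K .one → IPrv C Γ X → IPrv C (.one ::ₘ Γ) X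
  | botR {Γ} : C.K .bot → IPrv C Γ none → IPrv C Γ (some .bot)
  | limpL {Γ Δ X A B} : C.K (.limp A B) → IPrv C Γ (some A) → IPrv C (B ::ₘ Δ) X →
      IPrv C (.limp A B ::ₘ (Γ + Δ)) X
  | limpR {Γ A B} : C.K (.limp A B) → IPrv C (A ::ₘ Γ) (some B) →
      IPrv C Γ (some (.limp A B))
  | tensorL {Γ X A B} : C.K (.tensor A B) → IPrv C (A ::ₘ B ::ₘ Γ) X →
      IPrv C (.tensor A B ::ₘ Γ) X
  | tensorR {Γ Δ A B} : C.K (.tensor A B) → IPrv C Γ (some A) → IPrv C Δ (some B) →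
      IPrv C (Γ + Δ) (some (.tensor A B))
  | withL1 {Γ X A B} : C.K (.and A B) → IPrv C (A ::ₘ Γ) X → IPrv C (.and A B ::ₘ Γ) X
  | withL2 {Γ X A B} : C.K (.and A B) → IPrv C (B ::ₘ Γ) X → IPrv C (.and A B ::ₘ Γ) X
  | withR {Γ A B} : C.K (.and A B) → IPrv C Γ (some A) → IPrv C Γ (some B) →
      IPrv C Γ (some (.and A B))
  | plusL {Γ X A B} : C.K (.or A B) → IPrv C (A ::ₘ Γ) X → IPrv C (B ::ₘ Γ) X →
      IPrv C (.or A B ::ₘ Γ) X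
  | plusR1 {Γ A B} : C.K (.or A B) → IPrv C Γ (some A) → IPrv C Γ (some (.or A B))
  | plusR2 {Γ A B} : C.K (.or A B) → IPrv C Γ (some B) → IPrv C Γ (some (.or A B))
  | bangD {Γ X A} : C.bD → C.K (.bang A) → IPrv C (A ::ₘ Γ) X → IPrv C (.bang A ::ₘ Γ) X
  | bangP {Γ : Multiset IForm} {A} : C.bP → C.K (.bang A) → (∀ B ∈ Γ, C.K (.bang B)) →
      IPrv C (Γ.map .bang) (some A) → IPrv C (Γ.map .bang) (some (.bang A))
  | bangF {Γ : Multiset IForm} {A} : C.bF → C.K (.bang A) → (∀ B ∈ Γ, C.K (.bang B)) →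
      IPrv C Γ (some A) → IPrv C (Γ.map .bang) (some (.bang A))
  | weakL {Γ X A} : C.wL → C.K A → IPrv C Γ X → IPrv C (A ::ₘ Γ) X
  | bangW {Γ X A} : C.bW → C.K (.bang A) → IPrv C Γ X → IPrv C (.bang A ::ₘ Γ) X
  | bangC {Γ X A} : C.K (.bang A) → IPrv C (.bang A ::ₘ .bang A ::ₘ Γ) X →
      IPrv C (.bang A ::ₘ Γ) X
  | weakR {Γ A} : C.wR → C.K A → IPrv C Γ none → IPrv C Γ (some A)
  | lalBang {A} {E : Multiset IForm} : C.lB → C.K (.bang A) →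
      (∀ B ∈ E, C.K (.bang B)) → Multiset.card E ≤ 1 → IPrv C E (some A) →
      IPrv C (E.map .bang) (some (.bang A))
  | lalPara {Γ Δ : Multiset IForm} {A} : C.lP → C.K (.para A) → (∀ B ∈ Γ, C.K (.bang B)) →
      (∀ B ∈ Δ, C.K (.para B)) → IPrv C (Γ + Δ) (some A) →
      IPrv C (Γ.map .bang + Δ.map .para) (some (.para A))

/-- ILZW with a set of non-logical axioms. -/
def ILZWc (Φ : Set IForm) : ICalc :=
  ⟨IForm.inL, Φ, True, False, True, True, False, False, False, False⟩

/-- ILZW' = ILZW + right weakening, with a set of non-logical axioms. -/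
def ILZWpc (Φ : Set IForm) : ICalc :=
  ⟨IForm.inL, Φ, True, True, True, True, False, False, False, False⟩

/-- ILLW: the ⊥-free fragment of ILZW. -/
def ILLWc (Φ : Set IForm) : ICalc :=
  ⟨IForm.inLp, Φ, True, False, True, True, False, False, False, False⟩

/-- IEZW: intuitionistic elementary affine logic with bottom. -/
def IEZWc (Φ : Set IForm) : ICalc :=
  ⟨IForm.inL, Φ, True, False, False, False, True, False, False, False⟩

/-- IELW: the ⊥-free fragment of IEZW. -/
def IELWc (Φ : Set IForm) : ICalc :=
  ⟨IForm.inLp, Φ, True, False, False, False, True, False, False, False⟩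

/-- FLei: the {⊗,⊸,&,⊕,1,⊥}-fragment of ILZW. -/
def FLeic (Φ : Set IForm) : ICalc :=
  ⟨IForm.inFLei, Φ, True, False, True, True, False, False, False, False⟩

/-- FLew: the {⊗,⊸,&,⊕,1,⊥}-fragment of ILZW'. -/
def FLewc (Φ : Set IForm) : ICalc :=
  ⟨IForm.inFLei, Φ, True, True, True, True, False, False, False, False⟩

/-- FLei⁺: the {⊗,⊸,&,⊕,1}-fragment of ILZW. -/
def FLeiPc (Φ : Set IForm) : ICalc :=
  ⟨IForm.inFLeiP, Φ, True, False, True, True, False, False, False, False⟩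

/-- BCK: the {⊸}-fragment of ILZW. -/
def BCKc (Φ : Set IForm) : ICalc :=
  ⟨IForm.inImp, Φ, True, False, True, True, False, False, False, False⟩

/-- The {⊸,!}-fragment of ILLW. -/
def ImpBangILLWc (Φ : Set IForm) : ICalc :=
  ⟨IForm.inImpBang, Φ, True, False, True, True, False, False, False, False⟩

/-- ILL: intuitionistic linear logic (no unrestricted weakening, only !W). -/
def ILLc (Φ : Set IForm) : ICalc :=
  ⟨IForm.inLp, Φ, False, False, True, True, False, True, False, False⟩

/-- BCI: the {⊸}-fragment of ILL. -/
def BCIc (Φ : Set IForm) : ICalc :=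
  ⟨IForm.inImp, Φ, False, False, True, True, False, True, False, False⟩

/-- ILAL: intuitionistic light affine logic. -/
def ILALc (Φ : Set IForm) : ICalc :=
  ⟨IForm.inLAL, Φ, True, False, False, False, False, False, True, True⟩

/-- Classical formulas: literals p, p⊥ and the connectives ⊗, ⅋, &, ⊕, 1, ⊥, ⊤, 0, !, ?. -/
inductive CForm : Type where
  | pos (n : ℕ)
  | neg (n : ℕ)
  | one
  | bot
  | top
  | zero
  | tensor (A B : CForm)
  | par (A B : CForm)
  | and (A B : CForm)
  | or (A B : CForm)
  | bang (A : CForm)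
  | quest (A : CForm)

namespace CForm

/-- De Morgan (involutive) negation. -/
def dual : CForm → CForm
  | pos n => neg n
  | neg n => pos n
  | one => bot
  | bot => one
  | top => zero
  | zero => top
  | tensor A B => par A.dual B.dual
  | par A B => tensor A.dual B.dual
  | and A B => or A.dual B.dual
  | or A B => and A.dual B.dual
  | bang A => quest A.dual
  | quest A => bang A.dual

/-- the propositional variable `x` occurs in the formula -/
def hasVar (x : ℕ) : CForm → Prop
  | pos n => n = x
  | neg n => n = x
  | one => False
  | bot => False
  | top => False
  | zero => False
  | tensor A B => hasVar x A ∨ hasVar x B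
  | par A B => hasVar x A ∨ hasVar x B
  | and A B => hasVar x A ∨ hasVar x B
  | or A B => hasVar x A ∨ hasVar x B
  | bang A => hasVar x A
  | quest A => hasVar x A

/-- {⊗,⅋,&,⊕,1,⊥}-formulas (the language of InFLew) -/
def inMALL : CForm → Prop
  | pos _ => True
  | neg _ => True
  | one => True
  | bot => True
  | tensor A B => inMALL A ∧ inMALL B
  | par A B => inMALL A ∧ inMALL B
  | and A B => inMALL A ∧ inMALL B
  | or A B => inMALL A ∧ inMALL B
  | _ => False

end CForm

/-- A parametrized one-sided classical sequent calculus. -/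
structure CCalc where
  K : CForm → Prop
  ax : Set CForm
  wk : Prop      -- unrestricted weakening (W)
  der : Prop     -- dereliction (?)
  prom : Prop    -- promotion (!)
  funcF : Prop   -- the functorial rule (F) of ELLW
  qW : Prop      -- ?-weakening (?W), for LL

/-- Provability of a one-sided sequent `⊢ Γ` in the parametrized calculus `C`. -/
inductive CPrv (C : CCalc) : Multiset CForm → Prop where
  | axiom' {B} : B ∈ C.ax → CPrv C {B}
  | init {A} : C.K A → C.K A.dual → CPrv C {A, A.dual}
  | one : C.K .one → CPrv C {.one}
  | top {Γ} : C.K .top → (∀ A ∈ Γ, C.K A) → CPrv C (.top ::ₘ Γ)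
  | cut {Γ Δ A} : CPrv C (A ::ₘ Γ) → CPrv C (A.dual ::ₘ Δ) → CPrv C (Γ + Δ)
  | bot {Γ} : C.K .bot → CPrv C Γ → CPrv C (.bot ::ₘ Γ)
  | tensor {Γ Δ A B} : C.K (.tensor A B) → CPrv C (A ::ₘ Γ) → CPrv C (B ::ₘ Δ) →
      CPrv C (.tensor A B ::ₘ (Γ + Δ))
  | par {Γ A B} : C.K (.par A B) → CPrv C (A ::ₘ B ::ₘ Γ) → CPrv C (.par A B ::ₘ Γ)
  | with' {Γ A B} : C.K (.and A B) → CPrv C (A ::ₘ Γ) → CPrv C (B ::ₘ Γ) →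
      CPrv C (.and A B ::ₘ Γ)
  | plus1 {Γ A B} : C.K (.or A B) → CPrv C (A ::ₘ Γ) → CPrv C (.or A B ::ₘ Γ)
  | plus2 {Γ A B} : C.K (.or A B) → CPrv C (B ::ₘ Γ) → CPrv C (.or A B ::ₘ Γ)
  | der {Γ A} : C.der → C.K (.quest A) → CPrv C (A ::ₘ Γ) → CPrv C (.quest A ::ₘ Γ)
  | prom {Γ : Multiset CForm} {A} : C.prom → C.K (.bang A) → (∀ B ∈ Γ, C.K (.quest B)) →
      CPrv C (A ::ₘ Γ.map .quest) → CPrv C (.bang A ::ₘ Γ.map .quest)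
  | wk {Γ A} : C.wk → C.K A → CPrv C Γ → CPrv C (A ::ₘ Γ)
  | questW {Γ A} : C.qW → C.K (.quest A) → CPrv C Γ → CPrv C (.quest A ::ₘ Γ)
  | questC {Γ A} : C.K (.quest A) → CPrv C (.quest A ::ₘ .quest A ::ₘ Γ) →
      CPrv C (.quest A ::ₘ Γ)
  | funcF {Γ : Multiset CForm} {A} : C.funcF → C.K (.bang A) → (∀ B ∈ Γ, C.K (.quest B)) →
      CPrv C (A ::ₘ Γ) → CPrv C (.bang A ::ₘ Γ.map .quest)

/-- LLW: classical affine logic, with a set of non-logical axioms. -/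
def LLWc (Φ : Set CForm) : CCalc :=
  ⟨fun _ => True, Φ, True, True, True, False, False⟩

/-- ELLW: classical elementary affine logic. -/
def ELLWc (Φ : Set CForm) : CCalc :=
  ⟨fun _ => True, Φ, True, False, False, True, False⟩

/-- InFLew: the {⊗,⅋,&,⊕,1,⊥}-fragment of LLW. -/
def InFLewc (Φ : Set CForm) : CCalc :=
  ⟨CForm.inMALL, Φ, True, False, False, False, False⟩

/-- LL: classical linear logic (weakening restricted to ?W). -/
def LLc (Φ : Set CForm) : CCalc :=
  ⟨fun _ => True, Φ, False, True, True, False, True⟩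

/-- The translation (·)^[F] of classical formulas into intuitionistic formulas,
where ¬_F B := B ⊸ F. -/
def trF (F : IForm) : CForm → IForm
  | .pos n => .limp (.var n) F
  | .neg n => .var n
  | .one => .limp .one F
  | .bot => .one
  | .top => .zero
  | .zero => .limp .zero F
  | .tensor B C => .limp (.limp (trF F B) F) (trF F C)
  | .par B C => .limp (.limp (trF F B) (.limp (trF F C) F)) F
  | .and B C => .or (trF F B) (trF F C)
  | .or B C => .limp (.or (.limp (trF F B) F) (.limp (trF F C) F)) F
  | .bang B => .limp (.bang (.limp (trF F B) F)) F
  | .quest B => .bang (trF F B)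

/-- The embedding (·)̲ of ⊥-free intuitionistic formulas into classical formulas. -/
def emb : IForm → CForm
  | .var n => .pos n
  | .one => .one
  | .top => .top
  | .bot => .bot
  | .zero => .zero
  | .tensor A B => .tensor (emb A) (emb B)
  | .limp A B => .par (emb A).dual (emb B)
  | .and A B => .and (emb A) (emb B)
  | .or A B => .or (emb A) (emb B)
  | .bang A => .bang (emb A)
  | .para A => .bang (emb A)

end Affine

namespace Affine

open scoped Pointwise

/-- A set of classical sequents closed under the cut-free rules of classical elementary
affine logic. -/
structure IsPole (P : Set (Multiset CForm)) : Prop where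
  atom (n : ℕ) : {.neg n, .pos n} ∈ P
  one : {.one} ∈ P
  top (Γ : Multiset CForm) : .top ::ₘ Γ ∈ P
  weak {Γ : Multiset CForm} (A : CForm) : Γ ∈ P → A ::ₘ Γ ∈ P
  tensor {Γ Δ : Multiset CForm} {A B : CForm} : A ::ₘ Γ ∈ P → B ::ₘ Δ ∈ P →
    .tensor A B ::ₘ (Γ + Δ) ∈ P
  par {Γ : Multiset CForm} {A B : CForm} : A ::ₘ B ::ₘ Γ ∈ P → .par A B ::ₘ Γ ∈ P
  and {Γ : Multiset CForm} {A B : CForm} : A ::ₘ Γ ∈ P → B ::ₘ Γ ∈ P → .and A B ::ₘ Γ ∈ P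
  or_left {Γ : Multiset CForm} {A B : CForm} : A ::ₘ Γ ∈ P → .or A B ::ₘ Γ ∈ P
  or_right {Γ : Multiset CForm} {A B : CForm} : B ::ₘ Γ ∈ P → .or A B ::ₘ Γ ∈ P
  contr {Γ : Multiset CForm} {A : CForm} : .quest A ::ₘ .quest A ::ₘ Γ ∈ P → .quest A ::ₘ Γ ∈ P
  func {Γ : Multiset CForm} {A : CForm} : A ::ₘ Γ ∈ P → .bang A ::ₘ Γ.map .quest ∈ P

section Phase

variable (P : Set (Multiset CForm))

/-- The orthogonal of a set of sequents with respect to the pole `P`. -/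
def orth (S : Set (Multiset CForm)) : Set (Multiset CForm) :=
  {y | ∀ x ∈ S, x + y ∈ P}

variable {P}

theorem subset_orth_iff {S T : Set (Multiset CForm)} : S ⊆ orth P T ↔ T ⊆ orth P S := by
  constructor <;> intro h x hx y hy <;> rw [add_comm] <;> exact h hy x hx

theorem subset_orth_orth (S : Set (Multiset CForm)) : S ⊆ orth P (orth P S) :=
  subset_orth_iff.1 subset_rfl

theorem orth_anti {S T : Set (Multiset CForm)} (h : S ⊆ T) : orth P T ⊆ orth P S :=
  fun _ hy x hx => hy x (h hx)

@[simp]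
theorem orth_orth_orth (S : Set (Multiset CForm)) : orth P (orth P (orth P S)) = orth P S :=
  (orth_anti (subset_orth_orth S)).antisymm (subset_orth_orth _)

theorem orth_union (S T : Set (Multiset CForm)) : orth P (S ∪ T) = orth P S ∩ orth P T := by
  ext y
  simp only [orth, Set.mem_union, Set.mem_ofPred_eq, Set.mem_inter_iff, or_imp, forall_and]

theorem add_subset_iff_subset_orth {S T : Set (Multiset CForm)} :
    S + T ⊆ P ↔ T ⊆ orth P S := by
  rw [Set.add_subset_iff]
  exact ⟨fun h y hy x hx => h x hx y hy, fun h x hx y hy => h hy x hx⟩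

theorem orth_orth_add_subset (S T : Set (Multiset CForm)) :
    orth P (orth P S) + orth P (orth P T) ⊆ orth P (orth P (S + T)) := by
  rintro _ ⟨x, hx, y, hy, rfl⟩ w hw
  have key : ∀ s ∈ S, s + w ∈ orth P T := fun s hs t ht => by
    rw [show t + (s + w) = (s + t) + w by abel, add_comm, add_comm w]
    exact hw _ (Set.add_mem_add hs ht)
  have : y + w ∈ orth P S := fun s hs => by
    rw [show s + (y + w) = (s + w) + y by abel]
    exact hy _ (key s hs)
  rw [show w + (x + y) = (y + w) + x by abel]
  exact hx _ this

variable (P) in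
/-- The phase interpretation of classical formulas over the pole `P`. -/
def interp : CForm → Set (Multiset CForm)
  | .pos n => orth P {{.pos n}}
  | .neg n => orth P (orth P {{.pos n}})
  | .one => orth P (orth P {0})
  | .bot => orth P {0}
  | .top => orth P (orth P Set.univ)
  | .zero => orth P Set.univ
  | .tensor A B => orth P (orth P (interp A + interp B))
  | .par A B => orth P (orth P (interp A) + orth P (interp B))
  | .and A B => interp A ∩ interp B
  | .or A B => orth P (orth P (interp A) ∩ orth P (interp B))
  | .bang A => orth P (orth P (Multiset.map .quest '' interp A))
  | .quest A => orth P (Multiset.map .quest '' orth P (interp A))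

@[simp]
theorem orth_orth_interp (A : CForm) : orth P (orth P (interp P A)) = interp P A := by
  induction A with
  | and A B ihA ihB =>
    rw [interp, ← ihA, ← ihB, ← orth_union, orth_orth_orth]
  | _ => simp only [interp, orth_orth_orth]

theorem interp_dual (A : CForm) : interp P A.dual = orth P (interp P A) := by
  induction A with
  | or A B ihA ihB =>
    simp only [interp, CForm.dual, ihA, ihB]
    rw [← orth_union, orth_orth_orth]
  | _ => simp_all only [interp, CForm.dual, orth_orth_orth, orth_orth_interp]

variable (P) in
/-- The set of combined counter-elements of the formulas of a sequent. -/
def counter (Γ : Multiset CForm) : Set (Multiset CForm) :=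
  (Γ.map fun A => orth P (interp P A)).sum

@[simp]
theorem counter_zero : counter P 0 = {0} := by
  simp [counter, Set.singleton_zero]

@[simp]
theorem counter_cons (A : CForm) (Γ : Multiset CForm) :
    counter P (A ::ₘ Γ) = orth P (interp P A) + counter P Γ := by
  simp [counter]

@[simp]
theorem counter_add (Γ Δ : Multiset CForm) :
    counter P (Γ + Δ) = counter P Γ + counter P Δ := by
  simp [counter]

theorem counter_cons_subset_iff {A : CForm} {Γ : Multiset CForm} :
    counter P (A ::ₘ Γ) ⊆ P ↔ counter P Γ ⊆ interp P A := by
  rw [counter_cons, add_subset_iff_subset_orth, orth_orth_interp]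

theorem orth_singleton_zero : orth P {0} = P := by
  simp [orth]

theorem counter_map_quest_subset (Γ : Multiset CForm) :
    counter P (Γ.map .quest) ⊆ orth P (orth P (Multiset.map .quest '' counter P Γ)) := by
  induction Γ using Multiset.induction_on with
  | empty => simpa using subset_orth_orth (P := P) {0}
  | cons A Γ ih =>
    rw [Multiset.map_cons, counter_cons, counter_cons]
    refine (Set.add_subset_add_left ih).trans ((orth_orth_add_subset _ _).trans ?_)
    refine orth_anti (orth_anti ?_)
    rintro _ ⟨_, ⟨x, hx, rfl⟩, _, ⟨y, hy, rfl⟩, rfl⟩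
    exact ⟨x + y, Set.add_mem_add hx hy, Multiset.map_add _ _ _⟩

theorem map_quest_counter_subset (Γ : Multiset CForm) :
    Multiset.map .quest '' counter P Γ ⊆ counter P (Γ.map .quest) := by
  induction Γ using Multiset.induction_on with
  | empty => simp
  | cons A Γ ih =>
    rw [Multiset.map_cons, counter_cons, counter_cons]
    rintro _ ⟨_, ⟨x, hx, y, hy, rfl⟩, rfl⟩
    simp only [Multiset.map_add]
    exact Set.add_mem_add (subset_orth_orth _ ⟨x, hx, rfl⟩) (ih ⟨y, hy, rfl⟩)

theorem map_add_mem_of_cons_mem {g h : CForm → CForm}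
    (H : ∀ {A Γ}, g A ::ₘ Γ ∈ P → h A ::ₘ Γ ∈ P) {Γ Δ : Multiset CForm}
    (hΓ : Γ.map g + Δ ∈ P) : Γ.map h + Δ ∈ P := by
  induction Γ using Multiset.induction_on generalizing Δ with
  | empty => simpa using hΓ
  | cons A Γ ih =>
    rw [Multiset.map_cons, Multiset.cons_add] at hΓ ⊢
    rw [← Multiset.add_cons]
    apply ih
    rw [Multiset.add_cons]
    exact H hΓ

theorem IsPole.weak_add (hP : IsPole P) (Γ : Multiset CForm) {Δ : Multiset CForm}
    (hΔ : Δ ∈ P) : Γ + Δ ∈ P := by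
  induction Γ using Multiset.induction_on with
  | empty => simpa using hΔ
  | cons A Γ ih => rw [Multiset.cons_add]; exact hP.weak A ih

theorem IsPole.contr_add (hP : IsPole P) {Γ Δ : Multiset CForm}
    (h : Γ.map .quest + (Γ.map .quest + Δ) ∈ P) : Γ.map .quest + Δ ∈ P := by
  induction Γ using Multiset.induction_on generalizing Δ with
  | empty => simpa using h
  | cons A Γ ih =>
    simp only [Multiset.map_cons, Multiset.cons_add, Multiset.add_cons] at h ⊢
    rw [← Multiset.add_cons]
    apply ih
    simp only [Multiset.add_cons]
    exact hP.contr h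

theorem IsPole.interp_subset (hP : IsPole P) (A : CForm) : interp P A ⊆ orth P {{A}} := by
  have mem_orth {B : CForm} (h : interp P B ⊆ orth P {{B}}) : {B} ∈ orth P (interp P B) :=
    subset_orth_iff.1 h rfl
  have cons_mem {B : CForm} (h : interp P B ⊆ orth P {{B}}) {x} (hx : x ∈ interp P B) :
      B ::ₘ x ∈ P := by
    simpa using h hx _ rfl
  induction A with
  | pos n => exact subset_rfl
  | neg n =>
    refine orth_anti ?_
    rintro _ rfl _ rfl
    rw [add_comm]
    exact hP.atom n
  | one =>
    rw [interp, subset_orth_iff, orth_orth_orth, orth_singleton_zero]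
    rintro _ rfl
    exact hP.one
  | bot =>
    rw [interp, orth_singleton_zero]
    rintro x hx _ rfl
    exact hP.weak _ hx
  | top =>
    rintro x - _ rfl
    exact hP.top x
  | zero => exact orth_anti (Set.subset_univ _)
  | tensor A B ihA ihB =>
    rw [interp, subset_orth_iff, orth_orth_orth, subset_orth_iff]
    rintro _ ⟨x, hx, y, hy, rfl⟩ _ rfl
    exact hP.tensor (cons_mem ihA hx) (cons_mem ihB hy)
  | par A B ihA ihB =>
    rintro x hx _ rfl
    apply hP.par
    simpa [add_assoc] using hx _ (Set.add_mem_add (mem_orth ihA) (mem_orth ihB))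
  | and A B ihA ihB =>
    rintro x hx _ rfl
    exact hP.and (cons_mem ihA hx.1) (cons_mem ihB hx.2)
  | or A B ihA ihB =>
    refine orth_anti ?_
    rintro _ rfl
    constructor <;> intro x hx <;> rw [add_comm]
    · exact hP.or_left (cons_mem ihA hx)
    · exact hP.or_right (cons_mem ihB hx)
  | bang A ih =>
    rw [interp, subset_orth_iff, orth_orth_orth, subset_orth_iff]
    rintro _ ⟨x, hx, rfl⟩ _ rfl
    exact hP.func (cons_mem ih hx)
  | quest A ih =>
    refine orth_anti ?_
    rintro _ rfl
    exact ⟨{A}, mem_orth ih, rfl⟩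

theorem IsPole.mem_counter (hP : IsPole P) (Γ : Multiset CForm) : Γ ∈ counter P Γ := by
  induction Γ using Multiset.induction_on with
  | empty => simp
  | cons A Γ ih =>
    rw [counter_cons, ← Multiset.singleton_add]
    exact Set.add_mem_add (subset_orth_iff.1 (hP.interp_subset A) rfl) ih

theorem IsPole.counter_subset (hP : IsPole P) {C : CCalc} (hax : C.ax = ∅)
    (hder : C.der → ∀ {A Γ}, A ::ₘ Γ ∈ P → .quest A ::ₘ Γ ∈ P)
    (hprom : C.prom → ∀ {A Γ}, .quest (.quest A) ::ₘ Γ ∈ P → .quest A ::ₘ Γ ∈ P)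
    {Γ : Multiset CForm} (h : CPrv C Γ) : counter P Γ ⊆ P := by
  have weak {Γ : Multiset CForm} (A : CForm) (h : counter P Γ ⊆ P) :
      counter P (A ::ₘ Γ) ⊆ P := by
    rw [counter_cons]
    rintro _ ⟨x, -, y, hy, rfl⟩
    exact hP.weak_add x (h hy)
  induction h with
  | @init A _ _ =>
    rw [Multiset.insert_eq_cons, counter_cons_subset_iff, ← Multiset.cons_zero, counter_cons,
      counter_zero, interp_dual, orth_orth_interp]
    simp
  | one =>
    rw [← Multiset.cons_zero, counter_cons_subset_iff, counter_zero]
    exact subset_orth_orth _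
  | top =>
    rw [counter_cons_subset_iff]
    exact (Set.subset_univ _).trans (subset_orth_orth _)
  | cut _ _ ihA ihB =>
    rw [counter_cons_subset_iff] at ihA ihB
    rw [counter_add, add_subset_iff_subset_orth]
    rw [interp_dual] at ihB
    exact ihB.trans (orth_anti ihA)
  | bot _ _ ih => exact weak _ ih
  | tensor _ _ _ ihA ihB =>
    rw [counter_cons_subset_iff] at ihA ihB ⊢
    rw [counter_add]
    exact (Set.add_subset_add ihA ihB).trans (subset_orth_orth _)
  | par _ _ ih =>
    rw [counter_cons_subset_iff]
    rw [counter_cons, counter_cons, ← add_assoc, add_subset_iff_subset_orth] at ih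
    exact ih
  | with' _ _ _ ihA ihB =>
    rw [counter_cons_subset_iff] at ihA ihB ⊢
    exact Set.subset_inter ihA ihB
  | plus1 _ _ ih =>
    rw [counter_cons_subset_iff] at ih ⊢
    rw [interp, subset_orth_iff]
    exact Set.inter_subset_left.trans (orth_anti ih)
  | plus2 _ _ ih =>
    rw [counter_cons_subset_iff] at ih ⊢
    rw [interp, subset_orth_iff]
    exact Set.inter_subset_right.trans (orth_anti ih)
  | der hd _ _ ih =>
    rw [counter_cons, Set.add_subset_iff] at ih
    rw [counter_cons_subset_iff]
    rintro s hs _ ⟨x, hx, rfl⟩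
    apply map_add_mem_of_cons_mem (g := id) (hder hd)
    simpa using ih x hx s hs
  | @prom Γ A hp _ _ _ ih =>
    rw [counter_cons_subset_iff] at ih ⊢
    refine (counter_map_quest_subset Γ).trans ?_
    rw [interp, subset_orth_iff, orth_orth_orth, subset_orth_iff]
    rintro _ ⟨s, hs, rfl⟩ w hw
    rw [add_comm]
    apply map_add_mem_of_cons_mem (g := fun A => .quest (.quest A)) (hprom hp)
    have := hw _ ⟨_, ih (map_quest_counter_subset Γ ⟨s, hs, rfl⟩), rfl⟩
    rwa [Multiset.map_map] at this
  | wk _ _ _ ih => exact weak _ ih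
  | questW _ _ _ ih => exact weak _ ih
  | questC _ _ ih =>
    rw [counter_cons, counter_cons, Set.add_subset_iff] at ih
    rw [counter_cons_subset_iff]
    rintro s hs _ ⟨x, hx, rfl⟩
    have hx' := subset_orth_orth (P := P) _ (Set.mem_image_of_mem (Multiset.map .quest) hx)
    exact hP.contr_add (ih _ hx' _ (Set.add_mem_add hx' hs))
  | funcF _ _ _ _ ih =>
    rw [counter_cons_subset_iff] at ih ⊢
    exact (counter_map_quest_subset _).trans (orth_anti (orth_anti (Set.image_mono ih)))
  | _ => simp_all

theorem IsPole.mem_of_prv (hP : IsPole P) {C : CCalc} (hax : C.ax = ∅)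
    (hder : C.der → ∀ {A Γ}, A ::ₘ Γ ∈ P → .quest A ::ₘ Γ ∈ P)
    (hprom : C.prom → ∀ {A Γ}, .quest (.quest A) ::ₘ Γ ∈ P → .quest A ::ₘ Γ ∈ P)
    {Γ : Multiset CForm} (h : CPrv C Γ) : Γ ∈ P :=
  hP.counter_subset hax hder hprom h (hP.mem_counter Γ)

end Phase

theorem inLp_trF {F : IForm} (hF : F.inLp) (A : CForm) : (trF F A).inLp := by
  induction A <;> simp_all [trF, IForm.inLp]

theorem IPrv.limpL_self {C : ICalc} {Γ : Multiset IForm} {A F : IForm}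
    (hK : C.K (.limp A F)) (hF : C.K F) (h : IPrv C Γ (some A)) :
    IPrv C (.limp A F ::ₘ Γ) (some F) := by
  simpa using IPrv.limpL (Δ := 0) hK h (.init hF)

theorem isPole_trF {C : ICalc} {F : IForm} (hF : F.inLp) (hK : C.K = IForm.inLp) (hw : C.wL)
    (hfunc : ∀ {Γ : Multiset IForm} {A : IForm}, (∀ B ∈ Γ, C.K B) → C.K A →
      IPrv C Γ (some A) → IPrv C (Γ.map .bang) (some (.bang A))) :
    IsPole {Γ | IPrv C (Γ.map (trF F)) (some F)} := by
  have kF : C.K F := hK ▸ hF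
  have kt (A : CForm) : C.K (trF F A) := hK ▸ inLp_trF hF A
  have kl {A B : IForm} (hA : C.K A) (hB : C.K B) : C.K (.limp A B) := by
    rw [hK] at *; exact ⟨hA, hB⟩
  have ko {A B : IForm} (hA : C.K A) (hB : C.K B) : C.K (.or A B) := by
    rw [hK] at *; exact ⟨hA, hB⟩
  have kb {A : IForm} (hA : C.K A) : C.K (.bang A) := by
    rw [hK] at *; exact hA
  have k1 : C.K .one := by rw [hK]; trivial
  have k0 : C.K .zero := by rw [hK]; trivial
  have neg {A : IForm} {Γ : Multiset IForm} (hA : C.K A) (h : IPrv C (A ::ₘ Γ) (some F)) :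
      IPrv C Γ (some (.limp A F)) := .limpR (kl hA kF) h
  constructor
  · intro n
    simp only [Set.mem_ofPred_eq, Multiset.insert_eq_cons, Multiset.map_cons,
      Multiset.map_singleton]
    rw [← Multiset.cons_zero, Multiset.cons_swap]
    exact .limpL_self (kt (.pos n)) kF (.init (kt (.neg n)))
  · exact .limpL_self (Γ := 0) (kl k1 kF) kF (.oneR k1)
  · intro Γ
    simp only [Set.mem_ofPred_eq, Multiset.map_cons]
    refine .zeroL k0 ?_ ?_
    · simp only [Multiset.mem_map]
      rintro _ ⟨B, -, rfl⟩
      exact kt B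
    · rintro _ ⟨⟩
      exact kF
  · intro Γ A h
    simp only [Set.mem_ofPred_eq, Multiset.map_cons] at h ⊢
    exact .weakL hw (kt A) h
  · intro Γ Δ A B hA hB
    simp only [Set.mem_ofPred_eq, Multiset.map_cons, Multiset.map_add] at hA hB ⊢
    exact .limpL (kt (.tensor A B)) (neg (kt A) hA) hB
  · intro Γ A B h
    simp only [Set.mem_ofPred_eq, Multiset.map_cons] at h ⊢
    rw [Multiset.cons_swap] at h
    exact .limpL_self (kt (.par A B)) kF
      (.limpR (kl (kt A) (kl (kt B) kF)) (neg (kt B) h))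
  · intro Γ A B hA hB
    simp only [Set.mem_ofPred_eq, Multiset.map_cons] at hA hB ⊢
    exact .plusL (kt (.and A B)) hA hB
  · intro Γ A B h
    simp only [Set.mem_ofPred_eq, Multiset.map_cons] at h ⊢
    exact .limpL_self (kt (.or A B)) kF
      (.plusR1 (ko (kl (kt A) kF) (kl (kt B) kF)) (neg (kt A) h))
  · intro Γ A B h
    simp only [Set.mem_ofPred_eq, Multiset.map_cons] at h ⊢
    exact .limpL_self (kt (.or A B)) kF
      (.plusR2 (ko (kl (kt A) kF) (kl (kt B) kF)) (neg (kt B) h))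
  · intro Γ A h
    simp only [Set.mem_ofPred_eq, Multiset.map_cons] at h ⊢
    exact .bangC (kb (kt A)) h
  · intro Γ A h
    simp only [Set.mem_ofPred_eq, Multiset.map_cons] at h ⊢
    refine .limpL_self (kt (.bang A)) kF ?_
    have := hfunc (fun B hB => by
      obtain ⟨D, -, rfl⟩ := Multiset.mem_map.1 hB
      exact kt D) (kl (kt A) kF) (neg (kt A) h)
    rw [Multiset.map_map] at this ⊢
    exact this

theorem IPrv.bangD_add {C : ICalc} (hD : C.bD) {Γ Δ : Multiset IForm} {X : Option IForm}
    (hΓ : ∀ B ∈ Γ, C.K (.bang B)) (h : IPrv C (Γ + Δ) X) : IPrv C (Γ.map .bang + Δ) X := by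
  induction Γ using Multiset.induction_on generalizing Δ with
  | empty => simpa using h
  | cons A Γ ih =>
    rw [Multiset.map_cons, Multiset.cons_add, ← Multiset.add_cons]
    refine ih (fun B hB => hΓ B (Multiset.mem_cons_of_mem hB)) ?_
    rw [Multiset.add_cons]
    rw [Multiset.cons_add] at h
    exact .bangD hD (hΓ A (Multiset.mem_cons_self A Γ)) h

theorem IPrv.bang_of_bang_bang {C : ICalc} (hP : C.bP) {Γ : Multiset IForm} {X : Option IForm}
    {A : IForm} (hA : C.K (.bang A)) (hA' : C.K (.bang (.bang A)))
    (h : IPrv C (.bang (.bang A) ::ₘ Γ) X) : IPrv C (.bang A ::ₘ Γ) X := by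
  have := IPrv.bangP (Γ := {A}) hP hA' (by simpa using hA) (.init hA)
  simpa using IPrv.cut this h

/-- If `⊢ Γ` is provable in LLW (resp. ELLW) then `Γ^[F] ⊢ F` is provable in
ILLW (resp. IELW), for any ⊥-free intuitionistic formula F. -/
theorem llw_ellw_to_intuitionistic (Γ : Multiset CForm) (F : IForm)
    (hF : F.inLp) :
    (CPrv (LLWc ∅) Γ → IPrv (ILLWc ∅) (Γ.map (trF F)) (some F)) ∧
    (CPrv (ELLWc ∅) Γ → IPrv (IELWc ∅) (Γ.map (trF F)) (some F)) := by
  constructor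
  · intro h
    refine (isPole_trF (C := ILLWc ∅) hF rfl trivial ?_).mem_of_prv rfl ?_ ?_ h
    · intro Δ A hΔ hA hp
      refine .bangP trivial hA hΔ ?_
      simpa using IPrv.bangD_add (Δ := 0) (C := ILLWc ∅) trivial hΔ (by simpa using hp)
    · intro _ A Δ hp
      simp only [Set.mem_ofPred_eq, Multiset.map_cons] at hp ⊢
      exact .bangD trivial (inLp_trF hF A) hp
    · intro _ A Δ hp
      simp only [Set.mem_ofPred_eq, Multiset.map_cons] at hp ⊢
      exact .bang_of_bang_bang trivial (inLp_trF hF A) (inLp_trF hF A) hp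
  · intro h
    refine (isPole_trF (C := IELWc ∅) hF rfl trivial ?_).mem_of_prv rfl ?_ ?_ h
    · exact fun hΔ hA hp => .bangF trivial hA hΔ hp
    · exact fun h => h.elim
    · exact fun h => h.elim
end Affine
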